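/- arXiv:0910.4531 — 2 statements merged into one kernel-verified Lean document; each statement's English description precedes it below -/
import Mathlib

section
/- Let 𝔤 be a finite-dimensional complex semisimple Lie algebra equipped with a conjugation σ. If the complex dimension of 𝔤 is even, then there exists a complex Lie subalgebra 𝔮 of 𝔤 such that 𝔮 ∩ σ(𝔮) = {0} and 𝔮 + σ(𝔮) = 𝔤. -/
structure IsCj {g : Type*} [LieRing g] [LieAlgebra ℂ g] (σ : g → g) : Prop where
  add : ∀ x y, σ (x + y) = σ x + σ y
  smul : ∀ (z : ℂ) (x : g), σ (z • x) = (starRingEnd ℂ z) • σ x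
  lie : ∀ x y, σ ⁅x, y⁆ = ⁅σ x, σ y⁆
  inv : ∀ x, σ (σ x) = x

lemma mvpoly_real {ι : Type*} (P : MvPolynomial ι ℂ) (u w : ι → ℂ)
    (h : MvPolynomial.eval (fun i => Complex.I * u i + w i) P ≠ 0) :
    ∃ t : ℝ, MvPolynomial.eval (fun i => (t : ℂ) * u i + w i) P ≠ 0 := by
  let p : Polynomial ℂ := MvPolynomial.aeval
    (fun i => Polynomial.X * Polynomial.C (u i) + Polynomial.C (w i)) P
  have hp : ∀ t : ℂ, p.eval t = MvPolynomial.eval (fun i => t * u i + w i) P := by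
    intro t
    change (Polynomial.evalRingHom t) (MvPolynomial.aeval _ P) = _
    rw [MvPolynomial.aeval_def, MvPolynomial.hom_eval₂, ← MvPolynomial.eval₂_id]
    congr 1
    · ext <;> simp
    · ext i; simp; exact mul_comm _ _
  have hp0 : p ≠ 0 := by
    intro h0; apply h; rw [← hp, h0]; simp
  by_contra! H
  apply hp0
  apply Polynomial.eq_zero_of_infinite_isRoot
  apply Set.Infinite.mono (s := Set.range (fun t : ℝ => (t : ℂ)))
  · rintro _ ⟨t, rfl⟩
    change p.eval (t : ℂ) = 0
    rw [hp]; exact H t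
  · exact Set.infinite_range_of_injective Complex.ofReal_injective

namespace IsCj
open Module LieAlgebra LieSubalgebra

variable {g : Type*} [LieRing g] [LieAlgebra ℂ g] {σ : g → g}

lemma zero (hσ : IsCj σ) : σ 0 = 0 := by
  have := hσ.smul 0 0
  simpa using this

lemma neg (hσ : IsCj σ) (x : g) : σ (-x) = - σ x := by
  have := hσ.smul (-1) x
  simpa using this

lemma sub (hσ : IsCj σ) (x y : g) : σ (x - y) = σ x - σ y := by
  rw [sub_eq_add_neg, hσ.add, hσ.neg, sub_eq_add_neg]

lemma inj (hσ : IsCj σ) : Function.Injective σ := fun x y h => by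
  rw [← hσ.inv x, h, hσ.inv]

lemma ne_zero (hσ : IsCj σ) {x : g} (h : x ≠ 0) : σ x ≠ 0 := fun h' => h (hσ.inj (by rw [h', hσ.zero]))

/-- the real part -/
lemma decomp (hσ : IsCj σ) (x : g) : ∃ a b : g, σ a = a ∧ σ b = b ∧ x = Complex.I • b + a := by
  refine ⟨(1/2 : ℂ) • (x + σ x), (-Complex.I/2 : ℂ) • (x - σ x), ?_, ?_, ?_⟩
  · rw [hσ.smul, hσ.add, hσ.inv, add_comm]; simp [map_ofNat]
  · rw [hσ.smul, hσ.sub, hσ.inv]; simp only [map_div₀, map_neg, Complex.conj_I, map_ofNat]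
    module
  · rw [smul_smul, show Complex.I * (-Complex.I/2) = 1/2 by
      linear_combination (-1/2 : ℂ) * Complex.I_mul_I]
    module

lemma fixed_outside (hσ : IsCj σ) {Z W : Submodule ℂ g} (hZ : ∀ x ∈ Z, σ x ∈ Z) (h : ¬ Z ≤ W) :
    ∃ e ∈ Z, σ e = e ∧ e ∉ W := by
  by_contra! H
  apply h
  intro x hx
  obtain ⟨a, b, ha, hb, rfl⟩ := hσ.decomp x
  have h1 := hZ _ hx
  rw [hσ.add, hσ.smul, ha, hb, Complex.conj_I] at h1
  have ha' : a ∈ Z := by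
    have := Z.smul_mem (1/2 : ℂ) (Z.add_mem hx h1)
    convert this using 1; module
  have hb' : b ∈ Z := by
    have := Z.smul_mem (-Complex.I/2 : ℂ) (Z.sub_mem hx h1)
    convert this using 1
    rw [show Complex.I • b + a - (-Complex.I • b + a) = (2 * Complex.I) • b by module, smul_smul,
      show -Complex.I/2 * (2 * Complex.I) = 1 by ring_nf; simp]
    simp
  exact W.add_mem (W.smul_mem _ (H _ hb' hb)) (H _ ha' ha)

/-- image of a subspace -/
def mapSub (hσ : IsCj σ) (A : Submodule ℂ g) : Submodule ℂ g where
  carrier := {x | σ x ∈ A}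
  add_mem' := fun {a b} ha hb => by
    simp only [Set.mem_ofPred_eq] at *
    rw [hσ.add]; exact A.add_mem ha hb
  zero_mem' := by simp [hσ.zero]
  smul_mem' := fun c x hx => by
    simp only [Set.mem_ofPred_eq] at *
    rw [hσ.smul]; exact A.smul_mem _ hx

lemma mem_mapSub (hσ : IsCj σ) {A : Submodule ℂ g} {x : g} : x ∈ hσ.mapSub A ↔ σ x ∈ A := Iff.rfl

lemma finrank_mapSub (hσ : IsCj σ) (A : Submodule ℂ g) : finrank ℂ (hσ.mapSub A) = finrank ℂ A := by
  let j : hσ.mapSub A ≃+ A :=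
    { toFun := fun x => ⟨σ x, x.2⟩
      invFun := fun x => ⟨σ x, by rw [hσ.mem_mapSub, hσ.inv]; exact x.2⟩
      left_inv := fun x => by simp [hσ.inv]
      right_inv := fun x => by simp [hσ.inv]
      map_add' := fun x y => by ext; simp [hσ.add] }
  have := rank_eq_of_equiv_equiv (starRingEnd ℂ) j (starRingAut (R := ℂ)).bijective (fun r m => by
    ext; simp [j, hσ.smul])
  simp [finrank, this]

lemma exists_half (hσ : IsCj σ) [FiniteDimensional ℂ g] {Z : Submodule ℂ g} (hZ : ∀ x ∈ Z, σ x ∈ Z)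
    (hev : Even (finrank ℂ Z)) :
    ∃ A : Submodule ℂ g, A ≤ Z ∧ (∀ x ∈ A, σ x ∈ A → x = 0) ∧
      Z ≤ A ⊔ hσ.mapSub A := by
  classical
  let S : Set ℕ := {n | ∃ A : Submodule ℂ g, finrank ℂ A = n ∧ A ≤ Z ∧ (∀ x ∈ A, σ x ∈ A → x = 0)}
  have hne : S.Nonempty := ⟨0, ⊥, by simp, bot_le, by simp +contextual⟩
  have hbd : BddAbove S := ⟨finrank ℂ g, by
    rintro n ⟨A, rfl, -⟩; exact Submodule.finrank_le A⟩
  obtain ⟨A, hA, hAZ, hA0⟩ := Nat.sSup_mem hne hbd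
  refine ⟨A, hAZ, hA0, ?_⟩
  by_contra hcon
  set W := A ⊔ hσ.mapSub A with hW
  have hWσ : ∀ x ∈ W, σ x ∈ W := by
    intro x hx
    obtain ⟨a, ha, b, hb, rfl⟩ := Submodule.mem_sup.mp hx
    rw [hσ.add, add_comm]
    exact Submodule.mem_sup.mpr ⟨_, hb, _, by rw [hσ.mem_mapSub, hσ.inv]; exact ha, rfl⟩
  have hWZ : W ≤ Z := sup_le hAZ (fun x hx => by
    have := hZ _ (hAZ (hσ.mem_mapSub.mp hx)); rwa [hσ.inv] at this)
  have hWdim : finrank ℂ W = 2 * finrank ℂ A := by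
    have h1 := Submodule.finrank_sup_add_finrank_inf_eq A (hσ.mapSub A)
    have h2 : A ⊓ hσ.mapSub A = ⊥ := by
      rw [_root_.eq_bot_iff]; rintro x ⟨h1, h2⟩
      exact hA0 x h1 h2
    rw [h2, finrank_bot, hσ.finrank_mapSub, ← hW] at h1
    omega
  obtain ⟨e, heZ, he, heW⟩ := hσ.fixed_outside hZ hcon
  have hcon2 : ¬ Z ≤ W ⊔ Submodule.span ℂ {e} := by
    intro h
    have h3 : W ⊔ Submodule.span ℂ {e} = Z := le_antisymm (sup_le hWZ (by
      rw [Submodule.span_singleton_le_iff_mem]; exact heZ)) h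
    have h1 := Submodule.finrank_sup_add_finrank_inf_eq W (Submodule.span ℂ {e})
    have h2 : W ⊓ Submodule.span ℂ {e} = ⊥ := by
      rw [_root_.eq_bot_iff]
      rintro x ⟨hx1, hx2⟩
      obtain ⟨c, rfl⟩ := Submodule.mem_span_singleton.mp hx2
      by_cases hc : c = 0
      · simp [hc]
      · exact absurd ((W.smul_mem_iff hc).mp hx1) heW
    rw [h2, finrank_bot, h3, finrank_span_singleton (by rintro rfl; exact heW W.zero_mem)] at h1
    obtain ⟨k, hk⟩ := hev
    omega
  obtain ⟨f, hfZ, hf, hfW⟩ := hσ.fixed_outside hZ hcon2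
  have key : ∀ p q : ℂ, p • e + q • f ∈ W → p = 0 ∧ q = 0 := by
    intro p q h
    have hq : q = 0 := by
      by_contra hq
      apply hfW
      have h4 : f = q⁻¹ • (p • e + q • f) + (-(q⁻¹ * p)) • e := by
        rw [smul_add, smul_smul, smul_smul, inv_mul_cancel₀ hq]; module
      rw [h4]
      exact Submodule.add_mem_sup (W.smul_mem _ h)
        (Submodule.smul_mem _ _ (Submodule.mem_span_singleton_self e))
    subst hq
    refine ⟨?_, rfl⟩
    by_contra hp
    apply heW
    simp only [zero_smul, add_zero] at h
    have := W.smul_mem p⁻¹ h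
    rwa [smul_smul, inv_mul_cancel₀ hp, one_smul] at this
  set u := e + Complex.I • f with hu
  have hσu : σ u = e - Complex.I • f := by
    rw [hu, hσ.add, hσ.smul, he, hf, Complex.conj_I]; module
  have hmem : finrank ℂ (A ⊔ Submodule.span ℂ {u} : Submodule ℂ g) ∈ S := by
    refine ⟨_, rfl, sup_le hAZ ?_, ?_⟩
    · rw [Submodule.span_singleton_le_iff_mem]
      exact Z.add_mem heZ (Z.smul_mem _ hfZ)
    · intro x hx hx'
      obtain ⟨a, ha, b, hb, rfl⟩ := Submodule.mem_sup.mp hx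
      obtain ⟨c, rfl⟩ := Submodule.mem_span_singleton.mp hb
      obtain ⟨a', ha', b', hb', h5⟩ := Submodule.mem_sup.mp hx'
      obtain ⟨c', rfl⟩ := Submodule.mem_span_singleton.mp hb'
      rw [hσ.add, hσ.smul, hσu, hu] at h5
      have h6 : (c' - starRingEnd ℂ c) • e + (Complex.I * (c' + starRingEnd ℂ c)) • f ∈ W := by
        have : (c' - starRingEnd ℂ c) • e + (Complex.I * (c' + starRingEnd ℂ c)) • f
          = σ a - a' := by
          have h7 : σ a = a' + c' • (e + Complex.I • f)
            - (starRingEnd ℂ) c • (e - Complex.I • f) := by rw [h5]; abel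
          rw [h7]; module
        rw [this]
        exact W.sub_mem (hWσ _ (Submodule.mem_sup_left ha)) (Submodule.mem_sup_left ha')
      obtain ⟨h7, h8⟩ := key _ _ h6
      have h9 : c = 0 := by
        simp at h8
        have : starRingEnd ℂ c = 0 := by linear_combination (h8 - h7)/2
        simpa using this
      subst h9
      simp only [map_zero, sub_zero] at h7
      subst h7
      simp only [zero_smul, add_zero, map_zero] at h5 ⊢
      exact hA0 a ha (h5 ▸ ha')
  have h1 := le_csSup hbd hmem
  rw [← hA] at h1
  have h2 : A = A ⊔ Submodule.span ℂ {u} := Submodule.eq_of_le_of_finrank_le le_sup_left h1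
  have h3 : u ∈ A := by
    rw [h2]; exact Submodule.mem_sup_right (Submodule.mem_span_singleton_self u)
  have := key 1 Complex.I (by simpa [hu] using Submodule.mem_sup_left h3)
  simp at this

lemma exists_cartan (hσ : IsCj σ) [FiniteDimensional ℂ g] :
    ∃ H : LieSubalgebra ℂ g, H.IsCartanSubalgebra ∧ ∀ x ∈ H, σ x ∈ H := by
  classical
  obtain ⟨x, hx⟩ := LieAlgebra.exists_isRegular ℂ g
  obtain ⟨a, b, ha, hb, rfl⟩ := hσ.decomp x
  obtain ⟨t, ht⟩ : ∃ t : ℝ, LieAlgebra.IsRegular ℂ ((t : ℂ) • b + a) := by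
    let B := Module.finBasis ℂ g
    rw [LieAlgebra.isRegular_iff_coeff_polyCharpoly_rank_ne_zero ℂ B] at hx
    simp_rw [LieAlgebra.isRegular_iff_coeff_polyCharpoly_rank_ne_zero ℂ B]
    have hB : ∀ z : ℂ, (fun i => z * B.repr b i + B.repr a i) = B.repr (z • b + a) := by
      intro z; ext i; simp
    obtain ⟨t, ht⟩ := mvpoly_real _ (B.repr b) (B.repr a) (by rw [hB]; exact hx)
    exact ⟨t, by rw [hB] at ht; exact ht⟩
  set y := (t : ℂ) • b + a with hy
  have hσy : σ y = y := by
    rw [hy, hσ.add, hσ.smul, ha, hb]; simp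
  refine ⟨engel ℂ y, ⟨?_, normalizer_engel _ _⟩, ?_⟩
  · apply isNilpotent_of_forall_le_engel
    intro z hz
    set Ex : {x | ∃ z ∈ engel ℂ y, engel ℂ z = x} := ⟨engel ℂ y, y, self_mem_engel _ _, rfl⟩
    suffices IsBot Ex from @this ⟨engel ℂ z, z, hz, rfl⟩
    apply engel_isBot_of_isMin (Cardinal.natCast_le_aleph0.trans
      <| Cardinal.infinite_iff.mp inferInstance) (engel ℂ y) Ex le_rfl
    rintro ⟨_, w, hw, rfl⟩ hyx
    suffices finrank ℂ (engel ℂ y) ≤ finrank ℂ (engel ℂ w) by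
      suffices engel ℂ w = engel ℂ y from this.ge
      apply LieSubalgebra.toSubmodule_injective
      exact Submodule.eq_of_le_of_finrank_le hyx this
    rw [(isRegular_iff_finrank_engel_eq_rank ℂ y).mp ht]
    apply rank_le_finrank_engel
  · intro z hz
    rw [mem_engel_iff] at hz ⊢
    obtain ⟨n, hn⟩ := hz
    have : ∀ n z, ((ad ℂ g y) ^ n) (σ z) = σ (((ad ℂ g y) ^ n) z) := by
      intro n
      induction n with
      | zero => simp
      | succ n ih =>
        intro z
        rw [pow_succ, Module.End.mul_apply, Module.End.mul_apply, ← ih]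
        simp only [ad_apply]
        rw [hσ.lie, hσy]
    exact ⟨n, by rw [this, hn, hσ.zero]⟩


/-- sum of eigenspaces of `ad v` -/
noncomputable def eigSum (v : g) (s : Set ℂ) : Submodule ℂ g :=
  ⨆ μ ∈ s, Module.End.eigenspace (ad ℂ g v : Module.End ℂ g) μ

lemma eigSum_disj (v : g) {s t : Set ℂ} (h : Disjoint s t) :
    Disjoint (eigSum v s) (eigSum v t) :=
  (Module.End.eigenspaces_iSupIndep (ad ℂ g v : Module.End ℂ g)).disjoint_biSup_biSup h

lemma eigSum_le {v : g} {s : Set ℂ} {Q : Submodule ℂ g}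
    (h : ∀ μ ∈ s, ∀ x, ⁅v, x⁆ = μ • x → x ∈ Q) : eigSum v s ≤ Q := by
  refine iSup₂_le fun μ hμ x hx => h μ hμ x ?_
  rw [Module.End.mem_eigenspace_iff] at hx
  exact hx

lemma mem_eigSum {v : g} {s : Set ℂ} {μ : ℂ} (hμ : μ ∈ s) {x : g} (h : ⁅v, x⁆ = μ • x) :
    x ∈ eigSum v s := by
  have : Module.End.eigenspace (ad ℂ g v : Module.End ℂ g) μ ≤ eigSum v s :=
    le_iSup₂_of_le μ hμ le_rfl
  apply this
  rw [Module.End.mem_eigenspace_iff]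
  exact h

lemma eigSum_mono {v : g} {s t : Set ℂ} (h : s ⊆ t) : eigSum v s ≤ eigSum v t :=
  eigSum_le fun _ hμ _ hx => mem_eigSum (h hμ) hx

lemma eigSum_lie {v : g} {s t u : Set ℂ} (h : ∀ a ∈ s, ∀ b ∈ t, a + b ∈ u) {x y : g}
    (hx : x ∈ eigSum v s) (hy : y ∈ eigSum v t) : ⁅x, y⁆ ∈ eigSum v u := by
  have h1 : eigSum v t ≤ (eigSum v u).comap (ad ℂ g x : Module.End ℂ g) := by
    apply eigSum_le
    intro b hb y hy
    have h2 : eigSum v s ≤ (eigSum v u).comap (ad ℂ g y : Module.End ℂ g) := by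
      apply eigSum_le
      intro a ha x hx
      apply mem_eigSum (h a ha b hb)
      rw [ad_apply, leibniz_lie, hy, hx, smul_lie, lie_smul]
      module
    have h3 := h2 hx
    rw [Submodule.mem_comap, ad_apply, ← lie_skew, Submodule.neg_mem_iff] at h3
    exact h3
  exact h1 hy

/-- the conclusion -/
def Concl (σ : g → g) : Prop := ∃ q : LieSubalgebra ℂ g,
      (∀ x ∈ q, σ x ∈ q → x = 0) ∧
      (∀ x : g, ∃ u ∈ q, ∃ v ∈ q, x = u + σ v)

lemma top_aux [FiniteDimensional ℂ g] [IsKilling ℂ g]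
    (H : LieSubalgebra ℂ g) [H.IsCartanSubalgebra] (v : H)
    (hr : ∀ α : LieModule.Weight ℂ H g, α.IsNonZero → (α v).re ≠ 0) :
    H.toSubmodule ⊔ (eigSum (v : g) {μ | 0 < μ.re} ⊔ eigSum (v : g) {μ | μ.re < 0}) = ⊤ := by
  have h1 := LieModule.iSup_genWeightSpace_eq_top' ℂ H g
  rw [_root_.eq_top_iff]
  intro x _
  have hx : x ∈ ⨆ χ : LieModule.Weight ℂ H g, LieModule.genWeightSpace g χ := by
    rw [h1]; trivial
  induction hx using LieSubmodule.iSup_induction' with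
  | zero => exact Submodule.zero_mem _
  | add a b _ _ ha hb => exact Submodule.add_mem _ (ha trivial) (hb trivial)
  | mem χ x hx =>
    by_cases hχ : χ.IsZero
    · apply Submodule.mem_sup_left
      have h2 : x ∈ rootSpace H (0 : H → ℂ) := by
        have : (χ : H → ℂ) = 0 := hχ
        rw [this] at hx; exact hx
      have h3 := LieAlgebra.rootSpace_zero_eq ℂ g H
      rw [h3] at h2
      exact h2
    · have h2 := LieAlgebra.IsKilling.lie_eq_smul_of_mem_rootSpace hx v
      apply Submodule.mem_sup_right
      rcases lt_or_gt_of_ne (hr χ hχ) with h3 | h3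
      · exact Submodule.mem_sup_right (mem_eigSum (μ := χ v) h3 h2)
      · exact Submodule.mem_sup_left (mem_eigSum (μ := χ v) h3 h2)

lemma q_aux (A P Z : Submodule ℂ g) (hAH : A ≤ Z) (hab : ∀ x ∈ Z, ∀ y ∈ Z, ⁅x, y⁆ = 0)
    (hZP : ∀ x ∈ Z, ∀ y ∈ P, ⁅x, y⁆ ∈ P) (hPP : ∀ x ∈ P, ∀ y ∈ P, ⁅x, y⁆ ∈ P) :
    ∃ q : LieSubalgebra ℂ g, ∀ x, x ∈ q ↔ x ∈ A ⊔ P := by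
  let q : LieSubalgebra ℂ g :=
    { A ⊔ P with
      lie_mem' := by
        intro x y hx hy
        obtain ⟨a, ha, p, hp, rfl⟩ := Submodule.mem_sup.mp hx
        obtain ⟨a', ha', p', hp', rfl⟩ := Submodule.mem_sup.mp hy
        apply Submodule.mem_sup_right
        rw [add_lie, lie_add, lie_add, hab _ (hAH ha) _ (hAH ha'), zero_add, ← lie_skew p a']
        exact P.add_mem (hZP _ (hAH ha) _ hp') (P.add_mem (P.neg_mem (hZP _ (hAH ha') _ hp))
          (hPP _ hp _ hp')) }
  exact ⟨q, fun x => Iff.rfl⟩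

lemma final (hσ : IsCj σ) [FiniteDimensional ℂ g] [IsKilling ℂ g] (heven : Even (finrank ℂ g))
    (H : LieSubalgebra ℂ g) [H.IsCartanSubalgebra] (hH : ∀ x ∈ H, σ x ∈ H) (v : H)
    (hv : σ v = -v) (hr : ∀ α : LieModule.Weight ℂ H g, α.IsNonZero → (α v).re ≠ 0) :
    Concl σ := by
  set P := eigSum (v : g) {μ | 0 < μ.re} with hP
  set N := eigSum (v : g) {μ | μ.re < 0} with hN
  have hab : ∀ x ∈ H, ∀ y ∈ H, ⁅x, y⁆ = 0 := fun x hx y hy => by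
    have := trivial_lie_zero H H ⟨x, hx⟩ ⟨y, hy⟩
    simpa using congrArg Subtype.val this
  have hH0 : H.toSubmodule ≤ eigSum (v : g) {0} := fun x hx =>
    mem_eigSum (μ := 0) (Set.mem_singleton _) (by rw [hab _ v.2 x hx, zero_smul])
  have hPN : ∀ x, x ∈ P → σ x ∈ N := by
    intro x hx
    have : P ≤ hσ.mapSub N := by
      apply eigSum_le
      intro μ hμ y hy
      rw [mem_mapSub]
      have h1 := congrArg σ hy
      rw [hσ.lie, hv, hσ.smul, neg_lie] at h1
      refine mem_eigSum (μ := -(starRingEnd ℂ μ)) (by simpa using hμ) ?_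
      rw [neg_smul, ← h1, neg_neg]
    exact this hx
  have hNP : ∀ x, x ∈ N → σ x ∈ P := by
    intro x hx
    have : N ≤ hσ.mapSub P := by
      apply eigSum_le
      intro μ hμ y hy
      rw [mem_mapSub]
      have h1 := congrArg σ hy
      rw [hσ.lie, hv, hσ.smul, neg_lie] at h1
      refine mem_eigSum (μ := -(starRingEnd ℂ μ)) (by simpa using hμ) ?_
      rw [neg_smul, ← h1, neg_neg]
    exact this hx
  have hN' : N = hσ.mapSub P := by
    ext x; rw [mem_mapSub]
    exact ⟨hNP x, fun h => by have := hPN _ h; rwa [hσ.inv] at this⟩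
  have htop : H.toSubmodule ⊔ (P ⊔ N) = ⊤ := top_aux H v hr
  have hdPN : Disjoint P N := eigSum_disj _ (by
    rw [Set.disjoint_left]; intro a (ha : 0 < a.re) (hb : a.re < 0); linarith)
  have hdH : Disjoint H.toSubmodule (P ⊔ N) := by
    refine (eigSum_disj (v : g) (s := {0}) (t := {μ | μ.re ≠ 0}) ?_).mono hH0 (sup_le ?_ ?_)
    · simp
    · exact eigSum_mono fun a (ha : 0 < a.re) => ne_of_gt ha
    · exact eigSum_mono fun a (ha : a.re < 0) => ne_of_lt ha
  have hevH : Even (finrank ℂ H.toSubmodule) := by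
    have h1 := Submodule.finrank_sup_add_finrank_inf_eq H.toSubmodule (P ⊔ N)
    have h2 := Submodule.finrank_sup_add_finrank_inf_eq P N
    rw [htop, hdH.eq_bot, finrank_bot, finrank_top] at h1
    rw [hdPN.eq_bot, finrank_bot] at h2
    have h3 : finrank ℂ N = finrank ℂ P := by rw [hN']; exact hσ.finrank_mapSub P
    obtain ⟨k, hk⟩ := heven
    exact ⟨k - finrank ℂ P, by omega⟩
  obtain ⟨A, hAH, hA0, hAtop⟩ := hσ.exists_half (Z := H.toSubmodule) hH hevH
  have hZP : ∀ x ∈ H, ∀ y ∈ P, ⁅x, y⁆ ∈ P := fun x hx y hy =>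
    eigSum_lie (s := {0}) (t := {μ | 0 < μ.re}) (by
      rintro a rfl b hb; simpa using hb) (hH0 hx) hy
  have hPP : ∀ x ∈ P, ∀ y ∈ P, ⁅x, y⁆ ∈ P := fun x hx y hy =>
    eigSum_lie (s := {μ | 0 < μ.re}) (t := {μ | 0 < μ.re}) (by
      intro a (ha : 0 < a.re) b (hb : 0 < b.re); change 0 < (a + b).re
      simp; linarith) hx hy
  obtain ⟨q, hq⟩ := q_aux A P H.toSubmodule hAH hab hZP hPP
  refine ⟨q, ?_, ?_⟩
  · intro x hx hx'
    rw [hq] at hx hx'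
    obtain ⟨a, ha, p, hp, rfl⟩ := Submodule.mem_sup.mp hx
    obtain ⟨a', ha', p', hp', h⟩ := Submodule.mem_sup.mp hx'
    rw [hσ.add] at h
    have h1 : σ a - a' = p' - σ p := by
      rw [sub_eq_sub_iff_add_eq_add, ← h]; abel
    have h2 : σ a - a' = 0 := by
      apply Submodule.disjoint_def.mp hdH
      · exact Submodule.sub_mem _ (hH _ (hAH ha)) (hAH ha')
      · rw [h1]
        exact Submodule.sub_mem _ (Submodule.mem_sup_left hp') (Submodule.mem_sup_right (hPN _ hp))
    have h3 : p' = σ p := by rw [h2] at h1; exact sub_eq_zero.mp h1.symm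
    have h4 : σ p = 0 := Submodule.disjoint_def.mp hdPN _ (h3 ▸ hp') (hPN _ hp)
    have h5 : a = 0 := hA0 a ha (by rw [sub_eq_zero.mp h2]; exact ha')
    have h6 : p = 0 := by rw [← hσ.inv p, h4, hσ.zero]
    rw [h5, h6, add_zero]
  · intro x
    have hx : x ∈ H.toSubmodule ⊔ (P ⊔ N) := by rw [htop]; trivial
    obtain ⟨z, hz, y, hy, rfl⟩ := Submodule.mem_sup.mp hx
    obtain ⟨p, hp, n, hn, rfl⟩ := Submodule.mem_sup.mp hy
    obtain ⟨a, ha, b, hb, rfl⟩ := Submodule.mem_sup.mp (hAtop hz)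
    refine ⟨a + p, (hq _).mpr (Submodule.add_mem_sup ha hp), σ b + σ n,
      (hq _).mpr (Submodule.add_mem_sup hb (hNP _ hn)), ?_⟩
    rw [hσ.add, hσ.inv, hσ.inv]; abel

lemma Concl.conj {θ : g ≃ₗ⁅ℂ⁆ g} (h : Concl (fun x => θ.symm (σ (θ x)))) : Concl σ := by
  obtain ⟨q, h1, h2⟩ := h
  refine ⟨q.map θ.toLieHom, ?_, ?_⟩
  · intro x hx hx'
    obtain ⟨y, hy, rfl⟩ := hx
    obtain ⟨z, hz, hz'⟩ := hx'
    have := h1 y hy (by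
      change θ z = σ (θ y) at hz'
      change θ.symm (σ (θ y)) ∈ q
      rw [← hz', LieEquiv.symm_apply_apply]; exact hz)
    subst this
    exact map_zero θ
  · intro x
    obtain ⟨u, hu, v, hv, h⟩ := h2 (θ.symm x)
    refine ⟨θ u, ⟨u, hu, rfl⟩, θ v, ⟨v, hv, rfl⟩, ?_⟩
    have := congrArg θ h
    simpa using this

lemma conj (hσ : IsCj σ) (θ : g ≃ₗ⁅ℂ⁆ g) : IsCj (fun x => θ.symm (σ (θ x))) where
  add x y := by simp [hσ.add]
  smul z x := by simp [hσ.smul]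
  lie x y := by rw [LieEquiv.map_lie, hσ.lie, LieEquiv.map_lie]
  inv x := by simp [hσ.inv]

lemma exists_exp (e : g) (he : _root_.IsNilpotent (ad ℂ g e : Module.End ℂ g)) (a : ℂ) :
    ∃ θ : g ≃ₗ⁅ℂ⁆ g, ∀ x, ⁅e, ⁅e, ⁅e, x⁆⁆⁆ = 0 →
      θ x = x + a • ⁅e, x⁆ + (a ^ 2 / 2) • ⁅e, ⁅e, x⁆⁆ := by
  let mod : Module ℚ g := Module.compHom g (algebraMap ℚ ℂ)
  have hq : ∀ (q : ℚ) (x : g), q • x = (q : ℂ) • x := fun q x => rfl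
  let _ : LieAlgebra ℚ g := { mod with lie_smul := fun q x y => (by rw [hq, hq, lie_smul]) }
  let D : LieDerivation ℂ g g := a • LieDerivation.ad ℂ g e
  have hD : ∀ x, D.toLinearMap x = a • ⁅e, x⁆ := fun x => by
    change D x = _
    simp [D]
  have hD' : D.toLinearMap = a • (ad ℂ g e : Module.End ℂ g) := by
    ext x; rw [hD]; simp
  have hnil : _root_.IsNilpotent (D.toLinearMap : Module.End ℂ g) := by
    rw [hD']; exact he.smul a
  refine ⟨LieDerivation.exp D hnil, fun x hx => ?_⟩
  rw [LieDerivation.exp_map_apply]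
  have h3 : ((D.toLinearMap : Module.End ℂ g) ^ 3) • x = 0 := by
    simp only [Module.End.smul_def, pow_succ, pow_zero, one_mul, Module.End.mul_apply, hD,
      lie_smul, hx, smul_zero]
  have h4 := IsNilpotent.exp_smul_eq_sum h3 hnil
  rw [Module.End.smul_def] at h4
  refine h4.trans ?_
  simp only [Finset.sum_range_succ, Finset.sum_range_zero, zero_add, Module.End.smul_def, pow_succ,
    pow_zero, one_mul, Module.End.mul_apply, hD, lie_smul, hq, Module.End.one_apply,
    Nat.factorial]
  push_cast
  module

lemma exists_theta {h e f : g} (ht : IsSl2Triple h e f)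
    (he : _root_.IsNilpotent (ad ℂ g e : Module.End ℂ g))
    (hf : _root_.IsNilpotent (ad ℂ g f : Module.End ℂ g)) :
    ∃ θ : g ≃ₗ⁅ℂ⁆ g, θ h = Complex.I • (e - f) ∧ ∀ k, ⁅e, k⁆ = 0 → ⁅f, k⁆ = 0 → θ k = k := by
  obtain ⟨θ₁, h₁⟩ := exists_exp e he (-Complex.I / 2)
  obtain ⟨θ₂, h₂⟩ := exists_exp f hf (-Complex.I)
  have eh : ⁅e, h⁆ = (-2 : ℂ) • e := by
    rw [← lie_skew, ht.lie_h_e_nsmul]; module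
  have fh : ⁅f, h⁆ = (2 : ℂ) • f := by
    rw [← lie_skew, ht.lie_h_f_nsmul]; module
  have fe : ⁅f, e⁆ = - h := by
    rw [← lie_skew, ht.lie_e_f]
  refine ⟨θ₁.trans θ₂, ?_, ?_⟩
  · rw [LieEquiv.trans_apply, h₁ h (by rw [eh]; simp)]
    rw [eh, lie_smul, lie_self, smul_zero, smul_zero, add_zero, map_add, map_smul, map_smul]
    rw [h₂ h (by rw [fh]; simp), h₂ e (by rw [fe]; simp [fh]), fe, lie_neg, fh]
    simp only [lie_smul, lie_self, smul_zero, add_zero]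
    have hI : (-Complex.I) ^ 2 = -1 := by rw [neg_sq, Complex.I_sq]
    rw [hI]
    have hII : Complex.I * Complex.I = -1 := Complex.I_mul_I
    match_scalars <;> grind
  · intro k hk1 hk2
    rw [LieEquiv.trans_apply, h₁ k (by simp [hk1]), hk1]
    simp only [lie_zero, smul_zero, add_zero]
    rw [h₂ k (by simp [hk2]), hk2]
    simp

open LieAlgebra.IsKilling in
lemma generic [FiniteDimensional ℂ g] [IsKilling ℂ g]
    (H : LieSubalgebra ℂ g) [H.IsCartanSubalgebra] (v w : H) (α : LieModule.Weight ℂ H g)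
    (hα : α.IsNonZero) (hv : α v = 0) (hw : α w ≠ 0) :
    ∃ ε : ℝ, Set.ncard {β : LieModule.Weight ℂ H g | β.IsNonZero ∧ β (v + (ε : ℂ) • w) = 0} <
      Set.ncard {β : LieModule.Weight ℂ H g | β.IsNonZero ∧ β v = 0} := by
  classical
  have : Fintype (LieModule.Weight ℂ H g) := Fintype.ofFinite _
  obtain ⟨ε, hε⟩ := Infinite.exists_notMem_finset
    (insert (0 : ℝ) (Finset.univ.image fun β : LieModule.Weight ℂ H g => (-(β v) / (β w)).re))
  simp only [Finset.mem_insert, Finset.mem_image, Finset.mem_univ, true_and, not_or,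
    not_exists] at hε
  obtain ⟨hε0, hε1⟩ := hε
  refine ⟨ε, Set.ncard_lt_ncard ?_ (Set.toFinite _)⟩
  have hlin : ∀ β : LieModule.Weight ℂ H g, β (v + (ε : ℂ) • w) = β v + ε * β w := by
    intro β
    have := map_add β.toLinear v ((ε : ℂ) • w)
    rw [map_smul] at this
    simpa using this
  refine ⟨?_, ?_⟩
  · rintro β ⟨hβ, h⟩
    refine ⟨hβ, ?_⟩
    rw [hlin] at h
    by_cases hw : β w = 0
    · simpa [hw] using h
    · exfalso
      apply hε1 β
      have : -(β v) / (β w) = ε := by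
        rw [div_eq_iff hw]; linear_combination -h
      rw [this]; simp
  · intro hs
    have := (hs (show α ∈ _ from ⟨hα, hv⟩)).2
    rw [hlin, hv, zero_add] at this
    simp at this
    tauto

open LieAlgebra.IsKilling LieModule in
lemma mem_conj (hσ : IsCj σ) [FiniteDimensional ℂ g] [IsKilling ℂ g]
    (H : LieSubalgebra ℂ g) [H.IsCartanSubalgebra] (hH : ∀ x ∈ H, σ x ∈ H)
    {χ : H → ℂ} {x : g} (hx : x ∈ rootSpace H χ) :
    σ x ∈ rootSpace H (fun k : H => starRingEnd ℂ (χ ⟨σ k, hH k k.2⟩)) := by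
  apply weightSpace_le_genWeightSpace
  rw [mem_weightSpace]
  intro k
  have h1 := lie_eq_smul_of_mem_rootSpace hx ⟨σ k, hH k k.2⟩
  have h2 := congrArg σ h1
  rw [hσ.smul] at h2
  rw [← h2]
  change ⁅(k : g), σ x⁆ = σ ⁅σ k, x⁆
  rw [hσ.lie, hσ.inv]

lemma triple_conj (hσ : IsCj σ) {h e f : g} (ht : IsSl2Triple h e f) :
    IsSl2Triple (σ h) (σ e) (σ f) where
  h_ne_zero := hσ.ne_zero ht.h_ne_zero
  lie_e_f := by rw [← hσ.lie, ht.lie_e_f]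
  lie_h_e_nsmul := by rw [← hσ.lie, ht.lie_h_e_nsmul, two_nsmul, two_nsmul, hσ.add]
  lie_h_f_nsmul := by rw [← hσ.lie, ht.lie_h_f_nsmul, two_nsmul, two_nsmul, hσ.neg, hσ.add]

open LieAlgebra.IsKilling LieModule in
lemma exists_conj_weight (hσ : IsCj σ) [FiniteDimensional ℂ g] [IsKilling ℂ g]
    (H : LieSubalgebra ℂ g) [H.IsCartanSubalgebra] (hH : ∀ x ∈ H, σ x ∈ H)
    (α : Weight ℂ H g) (hα : α.IsNonZero) :
    ∃ β : Weight ℂ H g, β.IsNonZero ∧ (∀ k : H, β k = starRingEnd ℂ (α ⟨σ k, hH k k.2⟩)) ∧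
      σ (coroot α : H) = (coroot β : H) := by
  obtain ⟨h, e, f, ht, he, hf⟩ := exists_isSl2Triple_of_weight_isNonZero hα
  have hh := ht.h_eq_coroot hα he hf
  have he' := hσ.mem_conj H hH he
  have hf' := hσ.mem_conj H hH hf
  let β : Weight ℂ H g := ⟨fun k : H => starRingEnd ℂ (α ⟨σ k, hH k k.2⟩), by
    intro h0
    rw [rootSpace, h0] at he'
    exact hσ.ne_zero ht.e_ne_zero (by simpa using he')⟩
  have hβ : ∀ k : H, β k = starRingEnd ℂ (α ⟨σ k, hH k k.2⟩) := fun k => rfl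
  have hβ0 : β.IsNonZero := by
    intro h0
    apply hα
    have h1 : (β : H → ℂ) = 0 := h0
    change (α : H → ℂ) = 0
    ext k
    have h2 := congrFun h1 ⟨σ k, hH k k.2⟩
    rw [hβ] at h2
    simpa [hσ.inv] using h2
  refine ⟨β, hβ0, hβ, ?_⟩
  rw [← hh]
  refine (hσ.triple_conj ht).h_eq_coroot hβ0 he' ?_
  have hneg : (-β : H → ℂ) = fun k : H => starRingEnd ℂ ((-α : H → ℂ) ⟨σ k, hH k k.2⟩) := by
    ext k
    simp [hβ]
  rw [hneg]
  exact hf'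

open LieAlgebra.IsKilling LieModule in
lemma exists_fixed_triple (hσ : IsCj σ) [FiniteDimensional ℂ g] [IsKilling ℂ g]
    (H : LieSubalgebra ℂ g) [H.IsCartanSubalgebra] (hH : ∀ x ∈ H, σ x ∈ H)
    (α : Weight ℂ H g) (hα : α.IsNonZero)
    (hreal : ∀ k : H, α k = starRingEnd ℂ (α ⟨σ k, hH k k.2⟩))
    (hc : σ (coroot α : H) = (coroot α : H)) :
    ∃ e f : g, IsSl2Triple ((coroot α : H) : g) e f ∧ e ∈ rootSpace H α ∧ f ∈ rootSpace H (-α) ∧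
      σ e = e ∧ σ f = f := by
  obtain ⟨h, e, f, ht, he, hf⟩ := exists_isSl2Triple_of_weight_isNonZero hα
  have hh := ht.h_eq_coroot hα he hf
  have hstab : ∀ x ∈ rootSpace H α, σ x ∈ rootSpace H α := by
    intro x hx
    have := hσ.mem_conj H hH hx
    convert this using 2
    ext k; exact hreal k
  have hstab' : ∀ x ∈ rootSpace H (-α), σ x ∈ rootSpace H (-α) := by
    intro x hx
    have := hσ.mem_conj H hH hx
    convert this using 2
    ext k
    have := hreal k
    simp only [Pi.neg_apply, map_neg, neg_inj]; exact this
  obtain ⟨e', he'Z, he', he'0⟩ := hσ.fixed_outside (Z := (rootSpace H α).toSubmodule) (W := ⊥)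
    hstab (fun hle => ht.e_ne_zero (by simpa using hle he))
  have he'0 : e' ≠ 0 := fun h0 => he'0 (by simp [h0])
  obtain ⟨c, hce⟩ : ∃ c : ℂ, c • e = e' := by
    have h1 := finrank_rootSpace_eq_one α hα
    have := (finrank_eq_one_iff_of_nonzero' (⟨e, he⟩ : rootSpace H α)
      (by simpa [LieSubmodule.mk_eq_zero] using ht.e_ne_zero)).mp h1 ⟨e', he'Z⟩
    obtain ⟨c, hc⟩ := this
    exact ⟨c, congrArg Subtype.val hc⟩
  have hc0 : c ≠ 0 := by rintro rfl; simp at hce; exact he'0 hce.symm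
  have hf'Z : c⁻¹ • f ∈ rootSpace H (-α) := Submodule.smul_mem _ _ hf
  have hef : ⁅e', c⁻¹ • f⁆ = h := by
    rw [← hce, smul_lie, lie_smul, smul_smul, mul_inv_cancel₀ hc0, one_smul, ht.lie_e_f]
  have hf'0 : c⁻¹ • f ≠ 0 := smul_ne_zero (inv_ne_zero hc0) ht.f_ne_zero
  have ht' : IsSl2Triple h e' (c⁻¹ • f) :=
    { h_ne_zero := ht.h_ne_zero
      lie_e_f := hef
      lie_h_e_nsmul := by rw [← hce, lie_smul, ht.lie_h_e_nsmul, smul_comm]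
      lie_h_f_nsmul := by rw [lie_smul, ht.lie_h_f_nsmul, smul_neg, smul_comm] }
  refine ⟨e', c⁻¹ • f, hh ▸ ht', he'Z, hf'Z, he', ?_⟩
  obtain ⟨d, hd⟩ : ∃ d : ℂ, d • (c⁻¹ • f) = σ (c⁻¹ • f) := by
    have h1 := finrank_rootSpace_eq_one (-α) hα.neg
    have := (finrank_eq_one_iff_of_nonzero' (⟨c⁻¹ • f, hf'Z⟩ : rootSpace H (-α))
      (by simpa [LieSubmodule.mk_eq_zero] using hf'0)).mp h1 ⟨_, hstab' _ hf'Z⟩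
    obtain ⟨d, hd⟩ := this
    exact ⟨d, congrArg Subtype.val hd⟩
  have h1 := congrArg σ hef
  rw [hσ.lie, he', ← hd, lie_smul, hef, hh, hc, ← hh] at h1
  have : d = 1 := smul_left_injective ℂ ht.h_ne_zero (by simpa using h1)
  rw [← hd, this, one_smul]

open LieAlgebra.IsKilling LieModule in
lemma induct [FiniteDimensional ℂ g] [IsKilling ℂ g] (heven : Even (finrank ℂ g))
    (H : LieSubalgebra ℂ g) [H.IsCartanSubalgebra] (n : ℕ) :
    ∀ (σ : g → g) (_ : IsCj σ) (_ : ∀ x ∈ H, σ x ∈ H) (v : H) (_ : σ v = -v)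
      (_ : ∀ α : Weight ℂ H g, (α v).im = 0)
      (_ : Set.ncard {β : Weight ℂ H g | β.IsNonZero ∧ β v = 0} = n), Concl σ := by
  induction n using Nat.strong_induction_on with
  | _ n ih =>
  intro σ hσ hH v hv him hn
  by_cases hall : ∀ α : Weight ℂ H g, α.IsNonZero → (α v).re ≠ 0
  · exact hσ.final heven H hH v hv hall
  push Not at hall
  obtain ⟨α, hα, hre⟩ := hall
  have hαv : α v = 0 := Complex.ext hre (him α)
  have hadd : ∀ (β : Weight ℂ H g) (x y : H) (c : ℂ), β (x + c • y) = β x + c * β y := by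
    intro β x y c
    have := map_add β.toLinear x (c • y)
    rw [map_smul] at this
    simpa using this
  have hcorim : ∀ (β γ : Weight ℂ H g), (β (coroot γ)).im = 0 := by
    intro β γ
    rw [apply_coroot_eq_cast]
    exact Complex.intCast_im _
  obtain ⟨β, hβ, hβα, hcor⟩ := hσ.exists_conj_weight H hH α hα
  by_cases h2 : α (coroot β) = 2
  · have hβ2 : β (coroot α) = 2 := by
      rw [hβα]
      have : (⟨σ (coroot α : H), hH _ (coroot α).2⟩ : H) = coroot β := Subtype.ext hcor
      rw [this, h2]; simp [map_ofNat]
    have hαβ : α = β := by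
      have := (RootPairing.pairing_two_two_iff (rootSystem H) ⟨α, by simpa using hα⟩
        ⟨β, by simpa using hβ⟩).mp ⟨by simpa using h2, by simpa using hβ2⟩
      simpa using this
    subst hαβ
    obtain ⟨e, f, ht, heα, hfα, he, hf⟩ := hσ.exists_fixed_triple H hH α hα hβα hcor
    have hα0 : (α : H → ℂ) ≠ 0 := hα
    obtain ⟨θ, hθh, hθ⟩ := exists_theta ht
      (LieAlgebra.isNilpotent_ad_of_mem_rootSpace H hα0 heα)
      (LieAlgebra.isNilpotent_ad_of_mem_rootSpace H (neg_ne_zero.mpr hα0) hfα)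
    have hθ0 : ∀ k : H, α k = 0 → θ k = k := by
      intro k hk
      apply hθ
      · have := lie_eq_smul_of_mem_rootSpace heα k
        rw [hk, zero_smul] at this
        rw [← lie_skew, neg_eq_zero]; exact this
      · have := lie_eq_smul_of_mem_rootSpace hfα k
        rw [Pi.neg_apply, hk, neg_zero, zero_smul] at this
        rw [← lie_skew, neg_eq_zero]; exact this
    have hform : ∀ (k : H) (c : ℂ), α k = 0 →
        θ.symm (σ (θ (k + c • (coroot α : H) : H))) =
          σ k - (starRingEnd ℂ c) • ((coroot α : H) : g) := by
      intro k c hk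
      have hk' : α ⟨σ k, hH k k.2⟩ = 0 := by
        have := hβα k
        rw [hk] at this
        simpa using this.symm
      rw [← LieEquiv.symm_apply_apply θ (σ k - (starRingEnd ℂ c) • ((coroot α : H) : g))]
      congr 1
      rw [map_sub, map_smul, hθ0 ⟨σ k, hH k k.2⟩ hk', hθh]
      push_cast
      rw [map_add, map_smul, hθh, hθ0 k hk, hσ.add, hσ.smul, hσ.smul, hσ.sub, he, hf]
      simp only [Complex.conj_I]
      module
    obtain ⟨ε, hε⟩ := generic H v (coroot α) α hα hαv (by
      rw [root_apply_coroot hα]; norm_num)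
    rw [hn] at hε
    refine Concl.conj (θ := θ) (ih _ hε _ (hσ.conj θ) ?_ (v + (ε : ℂ) • coroot α) ?_ ?_ rfl)
    · intro x hx
      have hk : (⟨x, hx⟩ : H) = (⟨x, hx⟩ - (α ⟨x, hx⟩ / 2) • coroot α)
        + (α ⟨x, hx⟩ / 2) • coroot α := by abel
      have hk0 : α (⟨x, hx⟩ - (α ⟨x, hx⟩ / 2) • coroot α) = 0 := by
        rw [sub_eq_add_neg, ← neg_smul, hadd, root_apply_coroot hα]; ring
      have h3 := hform _ (α ⟨x, hx⟩ / 2) hk0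
      rw [← hk] at h3
      change θ.symm (σ (θ x)) = _ at h3
      change θ.symm (σ (θ x)) ∈ H
      rw [h3]
      exact H.sub_mem (hH _ (Subtype.mem _)) (H.smul_mem _ (Subtype.mem _))
    · change θ.symm (σ (θ _)) = _
      rw [hform v ε hαv, hv]
      simp
      abel
    · intro γ
      rw [hadd]
      simp [him γ, hcorim γ α]
  · obtain ⟨ε, hε⟩ := generic H v (coroot α - coroot β) α hα hαv (by
      have := hadd α (coroot α) (coroot β) (-1)
      rw [neg_one_smul, ← sub_eq_add_neg, root_apply_coroot hα] at this
      rw [this]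
      intro h0
      apply h2
      linear_combination -h0)
    rw [hn] at hε
    have hcor' : σ (coroot β : H) = (coroot α : H) := by rw [← hcor, hσ.inv]
    refine ih _ hε σ hσ hH (v + (ε : ℂ) • (coroot α - coroot β)) ?_ ?_ rfl
    · push_cast
      rw [hσ.add, hσ.smul, hσ.sub, hcor, hcor', hv, Complex.conj_ofReal]
      module
    · intro γ
      have := hadd γ (coroot α) (coroot β) (-1)
      rw [neg_one_smul, ← sub_eq_add_neg] at this
      rw [hadd, this]
      simp [him γ, hcorim γ α, hcorim γ β]

end IsCj

/-- Every even-dimensional complex semisimple Lie algebra with a conjugation `σ`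
(equivalently, every even-dimensional real semisimple Lie algebra) admits a
complex Lie subalgebra `𝔮` with `𝔮 ∩ σ(𝔮) = 0` and `𝔮 + σ(𝔮) = 𝔤`, i.e. a
left-invariant complex structure on the corresponding real Lie group. -/
theorem stmt_6 {g : Type*} [LieRing g] [LieAlgebra ℂ g] [FiniteDimensional ℂ g]
    [LieAlgebra.IsSemisimple ℂ g]
    (σ : g → g)
    (hσadd : ∀ x y, σ (x + y) = σ x + σ y)
    (hσsmul : ∀ (z : ℂ) (x : g), σ (z • x) = (starRingEnd ℂ z) • σ x)
    (hσbracket : ∀ x y, σ ⁅x, y⁆ = ⁅σ x, σ y⁆)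
    (hσinv : ∀ x, σ (σ x) = x)
    (heven : Even (Module.finrank ℂ g)) :
    ∃ q : LieSubalgebra ℂ g,
      (∀ x ∈ q, σ x ∈ q → x = 0) ∧
      (∀ x : g, ∃ u ∈ q, ∃ v ∈ q, x = u + σ v) := by
  have hσ : IsCj σ := ⟨hσadd, hσsmul, hσbracket, hσinv⟩
  have : LieAlgebra.IsKilling ℂ g := inferInstance
  obtain ⟨H, hC, hH⟩ := hσ.exists_cartan
  exact IsCj.induct heven H _ σ hσ hH 0 (by simp [hσ.zero]) (by simp) rfl
end

section
/- Let 𝔤 be a finite-dimensional complex semisimple Lie algebra equipped with a conjugation σ. If the complex dimension of 𝔤 is odd, then there exists a complex Lie subalgebra 𝔮 of 𝔤 such that 𝔮 ∩ σ(𝔮) = {0} and the complex subspace 𝔮 + σ(𝔮) has complex codimension 1 in 𝔤, i.e. dim_ℂ(𝔮 + σ(𝔮)) = dim_ℂ 𝔤 − 1. -/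
open Module

universe u v

lemma aux_trace_nonneg {V : Type*} [AddCommGroup V] [Module ℂ V] [FiniteDimensional ℂ V]
    (A : End ℂ V) (hA : ∀ μ, A.HasEigenvalue μ → μ.im = 0) :
    0 ≤ (LinearMap.trace ℂ V (A * A)).re ∧ (LinearMap.trace ℂ V (A * A)).im = 0 := by
  have key : ∀ μ ∈ (A * A).charpoly.roots, 0 ≤ μ.re ∧ μ.im = 0 := by
    intro μ hμ
    have h1 : (A * A).HasEigenvalue μ := by
      rw [End.hasEigenvalue_iff_isRoot_charpoly]
      exact (Polynomial.mem_roots'.1 hμ).2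
    have h2 : μ ∈ spectrum ℂ (A ^ 2) := by
      rw [pow_two]; exact h1.mem_spectrum
    rw [spectrum.map_pow_of_pos A (by norm_num : 0 < 2)] at h2
    obtain ⟨l, hl, rfl⟩ := h2
    have := hA l (End.hasEigenvalue_iff_mem_spectrum.2 hl)
    simp [pow_two, this, mul_self_nonneg]
  rw [End.trace_eq_sum_roots_charpoly_of_splits (IsAlgClosed.splits _)]
  generalize (A * A).charpoly.roots = s at key
  induction s using Multiset.induction_on with
  | empty => simp
  | cons a s ih =>
    have h1 := key a (by simp)
    have h2 := ih (fun μ hμ => key μ (by simp [hμ]))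
    simp only [Multiset.sum_cons, Complex.add_re, Complex.add_im]
    constructor
    · linarith [h1.1, h2.1]
    · linarith [h1.2, h2.2]

lemma aux_cs {V : Type*} [AddCommGroup V] [Module ℂ V]
    (H : V →ₗ⋆[ℂ] V →ₗ[ℂ] ℂ) (hs : ∀ u v, starRingEnd ℂ (H v u) = H u v)
    (hp : ∀ u, 0 ≤ (H u u).re) {u : V} (hu : H u u = 0) (v : V) : H u v = 0 ∧ H v u = 0 := by
  have key : H u v = 0 := by
    let c : PreInnerProductSpace.Core ℂ V :=
      { inner := fun x y => H x y
        conj_inner_symm := fun x y => hs x y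
        re_inner_nonneg := fun x => hp x
        add_left := fun x y z => by simp
        smul_left := fun x y r => by simp }
    have := InnerProductSpace.Core.inner_mul_inner_self_le (𝕜 := ℂ) (F := V) u v
    have h2 : ‖H u v‖ * ‖H v u‖ ≤ (H u u).re * (H v v).re := this
    rw [hu, ← hs u v] at h2
    simp at h2
    have h3 : ‖H v u‖ = 0 := by nlinarith [norm_nonneg (H v u)]
    rw [← hs, norm_eq_zero.1 h3]; simp
  exact ⟨key, by rw [← hs, key]; simp⟩

lemma aux_skew {V : Type*} [AddCommGroup V] [Module ℂ V] [FiniteDimensional ℂ V]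
    (H : V →ₗ⋆[ℂ] V →ₗ[ℂ] ℂ) (hs : ∀ u v, starRingEnd ℂ (H v u) = H u v)
    (hp : ∀ u, 0 ≤ (H u u).re) (A : End ℂ V) (hA : ∀ μ, A.HasEigenvalue μ → μ.im = 0)
    (hsk : ∀ u v, H (A u) v = - H u (A v)) (u v : V) : H (A u) v = 0 := by
  have h0 : ∀ (k : ℕ) (u : V), (A ^ k) u = 0 → H (A u) (A u) = 0 := by
    intro k
    induction k with
    | zero => intro u hu; simp at hu; simp [hu]
    | succ k ih =>
      intro u hu
      have h1 := ih (A u) (by simpa [pow_succ] using hu)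
      have h2 := (aux_cs H hs hp h1 u).2
      rw [hsk, h2, neg_zero]
  have h1 : ∀ (l : ℂ), l ≠ 0 → l.im = 0 → ∀ (k : ℕ) (u : V),
      ((A - algebraMap ℂ _ l) ^ k) u = 0 → H u u = 0 := by
    intro l hl hlr k
    induction k with
    | zero => intro u hu; simp at hu; simp [hu]
    | succ k ih =>
      intro u hu
      have h1 := ih ((A - algebraMap ℂ _ l) u) (by simpa [pow_succ] using hu)
      have h2 := (aux_cs H hs hp h1 u).2
      have h3 := (aux_cs H hs hp h1 u).1
      have hlc : starRingEnd ℂ l = l := Complex.conj_eq_iff_im.2 hlr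
      simp [Algebra.algebraMap_eq_smul_one, hlc] at h2 h3
      rw [hsk] at h3
      have : l * H u u = 0 := by linear_combination -(h2 + h3) / 2
      exact (mul_eq_zero.1 this).resolve_left hl
  have hu : u ∈ ⨆ μ, A.maxGenEigenspace μ := by
    rw [End.iSup_maxGenEigenspace_eq_top]; trivial
  induction hu using Submodule.iSup_induction' with
  | zero => simp
  | add x y _ _ hx hy => simp [hx, hy]
  | mem μ x hx =>
    by_cases hx0 : x = 0
    · simp [hx0]
    have hE : A.HasEigenvalue μ := by
      have : A.HasUnifEigenvalue μ ⊤ := fun h => hx0 (by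
        have hx' : x ∈ A.genEigenspace μ ⊤ := hx
        simpa [h] using hx')
      exact this.lt (by simp)
    obtain ⟨k, hk⟩ := (End.mem_maxGenEigenspace _ _ _).1 hx
    by_cases hμ : μ = 0
    · subst hμ
      exact (aux_cs H hs hp (h0 k x (by simpa using hk)) v).1
    · have := h1 μ hμ (hA μ hE) k x (by simpa [Algebra.algebraMap_eq_smul_one] using hk)
      rw [hsk, (aux_cs H hs hp this _).1, neg_zero]

lemma aux_lie_nilp {L : Type*} [LieRing L] [LieAlgebra ℂ L] [LieAlgebra.IsSolvable L] (x y z : L) :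
    ∀ (n : ℕ) (M : Type u) [AddCommGroup M] [Module ℂ M] [FiniteDimensional ℂ M]
    [LieRingModule L M] [LieModule ℂ L M], finrank ℂ M = n →
    ∃ k : ℕ, ∀ m : M, ((LieModule.toEnd ℂ L M x * LieModule.toEnd ℂ L M ⁅y, z⁆) ^ k) m = 0 := by
  intro n
  induction n using Nat.strong_induction_on with
  | _ n ih =>
  intro M _ _ _ _ _ hn
  cases subsingleton_or_nontrivial M with
  | inl h => exact ⟨0, fun m => Subsingleton.elim _ _⟩
  | inr h =>
  obtain ⟨χ, hχ⟩ := LieModule.exists_nontrivial_weightSpace_of_isSolvable ℂ L M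
  set N := LieModule.weightSpace M χ
  have hN : finrank ℂ (M ⧸ N) < n := by
    have h1 := Submodule.finrank_quotient_add_finrank N.toSubmodule
    have h2 : 0 < finrank ℂ N.toSubmodule := Module.finrank_pos_iff.2 hχ
    have h3 : finrank ℂ (M ⧸ N) = finrank ℂ (M ⧸ N.toSubmodule) := rfl
    omega
  obtain ⟨k, hk⟩ := ih _ hN (M ⧸ N) rfl
  refine ⟨k + 1, fun m => ?_⟩
  have hq : ∀ (j : ℕ) (m : M), LieSubmodule.Quotient.mk (N := N)
      (((LieModule.toEnd ℂ L M x * LieModule.toEnd ℂ L M ⁅y, z⁆) ^ j) m) =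
      ((LieModule.toEnd ℂ L (M ⧸ N) x * LieModule.toEnd ℂ L (M ⧸ N) ⁅y, z⁆) ^ j)
        (LieSubmodule.Quotient.mk m) := by
    intro j
    induction j with
    | zero => intro m; simp
    | succ j ihj =>
      intro m
      rw [pow_succ, pow_succ, Module.End.mul_apply, Module.End.mul_apply, ihj]
      rfl
  have hm : ((LieModule.toEnd ℂ L M x * LieModule.toEnd ℂ L M ⁅y, z⁆) ^ k) m ∈ N := by
    rw [← LieSubmodule.Quotient.mk_eq_zero]
    exact (hq k m).trans (hk _)
  rw [pow_succ', Module.End.mul_apply]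
  rw [LieModule.mem_weightSpace] at hm
  generalize ((LieModule.toEnd ℂ L M x * LieModule.toEnd ℂ L M ⁅y, z⁆) ^ k) m = w at hm
  simp [hm, smul_comm (χ y)]

lemma aux_traceForm_solv {L M : Type*} [LieRing L] [LieAlgebra ℂ L] [LieAlgebra.IsSolvable L]
    [AddCommGroup M] [Module ℂ M] [FiniteDimensional ℂ M]
    [LieRingModule L M] [LieModule ℂ L M] (x y z : L) :
    LieModule.traceForm ℂ L M x ⁅y, z⁆ = 0 := by
  rw [LieModule.traceForm_apply_apply]
  obtain ⟨k, hk⟩ := aux_lie_nilp x y z _ M rfl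
  exact (LinearMap.isNilpotent_trace_of_isNilpotent ⟨k, LinearMap.ext hk⟩).eq_zero

section conj
variable {L : Type*} [LieRing L] [LieAlgebra ℂ L] [FiniteDimensional ℂ L]
  (σ : L →ₗ⋆[ℂ] L)

lemma aux_decomp {V : Type*} [AddCommGroup V] [Module ℂ V] (σ : V →ₗ⋆[ℂ] V)
    (hinv : ∀ x, σ (σ x) = x) (x : V) :
    ∃ a b, σ a = a ∧ σ b = b ∧ x = a + Complex.I • b := by
  refine ⟨(1/2 : ℂ) • (x + σ x), (-Complex.I/2) • (x - σ x), ?_, ?_, ?_⟩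
  · simp only [LinearMap.map_smulₛₗ, map_add, hinv, map_div₀, map_one, map_ofNat]
    module
  · simp only [LinearMap.map_smulₛₗ, map_sub, hinv, map_div₀, map_neg, Complex.conj_I, map_ofNat]
    module
  · rw [smul_smul]
    have : Complex.I * (-Complex.I / 2) = 1/2 := by
      linear_combination (-1/2) * Complex.I_mul_I
    rw [this]; module

lemma aux_solvable (hbr : ∀ x y, σ ⁅x, y⁆ = ⁅σ x, σ y⁆) (hinv : ∀ x, σ (σ x) = x)
    (hreal : ∀ X, σ X = X → ∀ μ, (LieAlgebra.ad ℂ L X).HasEigenvalue μ → μ.im = 0) :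
    LieAlgebra.IsSolvable L := by
  set B := killingForm ℂ L with hB
  have hBs : ∀ x y, B x y = B y x := LieModule.traceForm_comm ℂ L L
  have hBp : ∀ x, σ x = x → 0 ≤ (B x x).re ∧ (B x x).im = 0 := fun x hx => by
    rw [hB, killingForm_apply_apply]
    exact aux_trace_nonneg _ (hreal x hx)
  have hBr : ∀ x y, σ x = x → σ y = y → (B x y).im = 0 := fun x y hx hy => by
    have h1 := (hBp (x + y) (by simp [hx, hy])).2
    have h2 := (hBp x hx).2
    have h3 := (hBp y hy).2
    have h4 := hBs y x
    simp [h4] at h1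
    linarith
  let H : L →ₗ⋆[ℂ] L →ₗ[ℂ] ℂ := LinearMap.comp B σ
  have hH : ∀ u v, H u v = B (σ u) v := fun _ _ => rfl
  have hs : ∀ u v, starRingEnd ℂ (H v u) = H u v := by
    intro u v
    obtain ⟨a, b, ha, hb, rfl⟩ := aux_decomp σ hinv u
    obtain ⟨c, d, hc, hd, rfl⟩ := aux_decomp σ hinv v
    simp only [hH, map_add, LinearMap.map_smulₛₗ, ha, hb, hc, hd, LinearMap.add_apply,
      LinearMap.smul_apply, map_smul, smul_eq_mul, map_mul,
      Complex.conj_eq_iff_im.2 (hBr _ _ hc ha), Complex.conj_eq_iff_im.2 (hBr _ _ hc hb),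
      Complex.conj_eq_iff_im.2 (hBr _ _ hd ha), Complex.conj_eq_iff_im.2 (hBr _ _ hd hb)]
    simp [hBs c, hBs d]
    ring
  have hp : ∀ u, 0 ≤ (H u u).re := by
    intro u
    obtain ⟨a, b, ha, hb, rfl⟩ := aux_decomp σ hinv u
    have h1 := (hBp a ha).1
    have h2 := (hBp b hb).1
    have h3 := hBr a b ha hb
    simp [hH, ha, hb, hBs b a]
    linarith
  have key : ∀ X, σ X = X → ∀ u v, B v ⁅X, u⁆ = 0 := by
    intro X hX u v
    have := aux_skew H hs hp (LieAlgebra.ad ℂ L X) (hreal X hX) (by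
      intro u v
      simp only [hH, LieAlgebra.ad_apply, hbr, hX]
      exact LieModule.traceForm_apply_lie_apply' ℂ L L X (σ u) v) (σ u) v
    rw [hH, LieAlgebra.ad_apply, hbr, hX, hinv] at this
    rw [hBs, this]
  apply LieAlgebra.isSolvable_of_killingForm_apply_lie_eq_zero (R := ℂ)
  intro x y hy
  have hy' : y ∈ (LieAlgebra.derivedSeries ℂ L 1).toSubmodule := hy
  have : LieAlgebra.derivedSeries ℂ L 1 = ⁅(⊤ : LieIdeal ℂ L), (⊤ : LieIdeal ℂ L)⁆ := rfl
  rw [this, LieSubmodule.lieIdeal_oper_eq_linear_span'] at hy'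
  clear hy
  induction hy' using Submodule.span_induction with
  | zero => simp
  | add a b _ _ ha hb => rw [map_add, ha, hb, add_zero]
  | smul c a _ ha => rw [map_smul, ha, smul_zero]
  | mem a ha => 
    obtain ⟨p, -, q, -, rfl⟩ := ha
    obtain ⟨a, b, ha, hb, rfl⟩ := aux_decomp σ hinv p
    rw [add_lie, smul_lie, map_add, map_smul]
    show B _ _ + _ • B _ _ = 0
    rw [key a ha, key b hb]; simp
end conj

lemma aux_finrank_map {V : Type*} [AddCommGroup V] [Module ℂ V] (σ : V →ₗ⋆[ℂ] V)
    (hinv : ∀ x, σ (σ x) = x) (W : Submodule ℂ V) :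
    finrank ℂ (W.map σ) = finrank ℂ W := by
  let j : W ≃+ W.map σ :=
    { toFun := fun x => ⟨σ x, Submodule.mem_map_of_mem x.2⟩
      invFun := fun y => ⟨σ y, by
        obtain ⟨y, hy⟩ := y
        obtain ⟨x, hx, rfl⟩ := Submodule.mem_map.1 hy
        simpa [hinv] using hx⟩
      left_inv := fun x => by simp [hinv]
      right_inv := fun x => by simp [hinv]
      map_add' := fun x y => by ext; simp }
  have := rank_eq_of_equiv_equiv (starRingEnd ℂ) j (starRingAut (R := ℂ)).bijective
    (fun r m => by ext; simp [j])
  rw [finrank, finrank, this]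

lemma aux_exists_fixed {V : Type*} [AddCommGroup V] [Module ℂ V] (σ : V →ₗ⋆[ℂ] V)
    (hinv : ∀ x, σ (σ x) = x) (W : Submodule ℂ V) (hW : W ≠ ⊤) : ∃ v, σ v = v ∧ v ∉ W := by
  by_contra! h
  apply hW
  rw [eq_top_iff]
  intro x _
  obtain ⟨a, b, ha, hb, rfl⟩ := aux_decomp σ hinv x
  exact W.add_mem (h a ha) (W.smul_mem _ (h b hb))

lemma aux_half {V : Type*} [AddCommGroup V] [Module ℂ V] [FiniteDimensional ℂ V]
    (σ : V →ₗ⋆[ℂ] V) (hinv : ∀ x, σ (σ x) = x) (k : ℕ) (hk : 2 * k ≤ finrank ℂ V) :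
    ∃ a : Submodule ℂ V, (∀ x ∈ a, σ x ∈ a → x = 0) ∧ finrank ℂ a = k := by
  induction k with
  | zero => exact ⟨⊥, by simp, by simp⟩
  | succ k ih =>
    obtain ⟨a, ha, hak⟩ := ih (by omega)
    set W := a ⊔ a.map σ with hWdef
    have haW : a ≤ W := le_sup_left
    have hsW : ∀ x ∈ a, σ x ∈ W := fun x hx =>
      (le_sup_right : a.map σ ≤ W) (Submodule.mem_map_of_mem hx)
    have hW : finrank ℂ W ≤ 2 * k := by
      have := Submodule.finrank_add_le_finrank_add_finrank a (a.map σ)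
      rw [aux_finrank_map σ hinv, hak, ← hWdef] at this
      omega
    have ht : finrank ℂ (⊤ : Submodule ℂ V) = finrank ℂ V := finrank_top ℂ V
    obtain ⟨v, hv, hvW⟩ := aux_exists_fixed σ hinv W (by
      intro h; rw [h] at hW; omega)
    have hs : ∀ v : V, finrank ℂ (ℂ ∙ v) ≤ 1 := fun v => by
      simpa using finrank_span_le_card (R := ℂ) ({v} : Set V)
    obtain ⟨u, hu, huW⟩ := aux_exists_fixed σ hinv (W ⊔ ℂ ∙ v) (by
      intro h
      have := Submodule.finrank_add_le_finrank_add_finrank W (ℂ ∙ v)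
      rw [h] at this
      have := hs v
      omega)
    have hlin : ∀ c d : ℂ, c • v + d • u ∈ W → c = 0 ∧ d = 0 := by
      intro c d h
      have hd : d = 0 := by
        by_contra hd
        apply huW
        rw [Submodule.mem_sup]
        refine ⟨d⁻¹ • (c • v + d • u), W.smul_mem _ h, (-(d⁻¹ * c)) • v,
          Submodule.smul_mem _ _ (Submodule.mem_span_singleton_self v), ?_⟩
        rw [smul_add, smul_smul, smul_smul, inv_mul_cancel₀ hd]
        module
      subst hd
      refine ⟨?_, rfl⟩
      by_contra hc
      apply hvW
      have := W.smul_mem c⁻¹ h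
      simpa [smul_smul, inv_mul_cancel₀ hc] using this
    set w := v + Complex.I • u with hw
    have hwa : w ∉ a := fun h => by
      have := hlin 1 Complex.I (by simpa using haW h)
      simp at this
    refine ⟨a ⊔ ℂ ∙ w, ?_, ?_⟩
    · intro x hx hσx
      obtain ⟨p, hp, y, hy, rfl⟩ := Submodule.mem_sup.1 hx
      obtain ⟨c, rfl⟩ := Submodule.mem_span_singleton.1 hy
      obtain ⟨p', hp', y', hy', he⟩ := Submodule.mem_sup.1 hσx
      obtain ⟨c', rfl⟩ := Submodule.mem_span_singleton.1 hy'
      have hmem : σ p - p' ∈ W := W.sub_mem (hsW p hp) (haW hp')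
      have he2 : σ p - p' = (c' - starRingEnd ℂ c) • v +
          (Complex.I * (c' + starRingEnd ℂ c)) • u := by
        simp only [hw, map_add, LinearMap.map_smulₛₗ, hv, hu, Complex.conj_I] at he
        rw [sub_eq_iff_eq_add]
        have : σ p = p' + c' • (v + Complex.I • u) -
          (starRingEnd ℂ) c • (v + (-Complex.I) • u) := by rw [he]; abel
        rw [this]; module
      rw [he2] at hmem
      obtain ⟨h1, h2⟩ := hlin _ _ hmem
      have h3 : c' + starRingEnd ℂ c = 0 := (mul_eq_zero.1 h2).resolve_left Complex.I_ne_zero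
      have h4 : starRingEnd ℂ c = 0 := by linear_combination (h3 - h1) / 2
      have h5 : c' = 0 := by linear_combination h3 - h4
      have h6 : c = 0 := by simpa using h4
      subst h5 h6
      simp only [zero_smul, add_zero] at he ⊢
      exact ha p hp (he ▸ hp')
    · have h1 := Submodule.finrank_add_le_finrank_add_finrank a (ℂ ∙ w)
      have h2 := hs w
      have h3 : a < a ⊔ ℂ ∙ w := lt_of_le_of_ne le_sup_left (fun h => hwa (by
        rw [h]; exact (le_sup_right : (ℂ ∙ w) ≤ _) (Submodule.mem_span_singleton_self w)))
      have h4 := Submodule.finrank_lt_finrank_of_lt h3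
      omega

section grading
variable {L : Type*} [LieRing L] [LieAlgebra ℂ L]

/-- Sum of the generalized eigenspaces of `ad X` for eigenvalues in `S`. -/
def auxE (X : L) (S : Set ℂ) : Submodule ℂ L :=
  ⨆ μ ∈ S, (LieAlgebra.ad ℂ L X).maxGenEigenspace μ

lemma auxE_le (X : L) {S : Set ℂ} {P : Submodule ℂ L}
    (h : ∀ μ ∈ S, ∀ x ∈ (LieAlgebra.ad ℂ L X).maxGenEigenspace μ, x ∈ P) :
    auxE X S ≤ P := iSup₂_le h

lemma auxE_mem (X : L) {S : Set ℂ} {μ : ℂ} (hμ : μ ∈ S) {x : L}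
    (hx : x ∈ (LieAlgebra.ad ℂ L X).maxGenEigenspace μ) : x ∈ auxE X S :=
  (le_iSup₂ (f := fun μ (_ : μ ∈ S) => (LieAlgebra.ad ℂ L X).maxGenEigenspace μ) μ hμ) hx

lemma auxE_lie (X : L) {S T U : Set ℂ} (h : ∀ s ∈ S, ∀ t ∈ T, s + t ∈ U) {x y : L}
    (hx : x ∈ auxE X S) (hy : y ∈ auxE X T) : ⁅x, y⁆ ∈ auxE X U := by
  have h1 : auxE X S ≤ (auxE X U).comap (LieAlgebra.ad ℂ L y) := by
    refine auxE_le X fun s hs a ha => ?_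
    have h2 : auxE X T ≤ (auxE X U).comap (LieAlgebra.ad ℂ L a) := by
      refine auxE_le X fun t ht b hb => ?_
      exact auxE_mem X (h s hs t ht) (LieModule.lie_mem_maxGenEigenspace_toEnd ha hb)
    have h3 : ⁅a, y⁆ ∈ auxE X U := h2 hy
    show ⁅y, a⁆ ∈ auxE X U
    rw [← lie_skew]
    exact Submodule.neg_mem _ h3
  have h4 : ⁅y, x⁆ ∈ auxE X U := h1 hx
  rw [← lie_skew]
  exact Submodule.neg_mem _ h4

lemma auxE_conj (σ : L →ₗ⋆[ℂ] L) (hbr : ∀ x y, σ ⁅x, y⁆ = ⁅σ x, σ y⁆) {X : L} (hX : σ X = X)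
    {S T : Set ℂ} (h : ∀ s ∈ S, starRingEnd ℂ s ∈ T) {x : L} (hx : x ∈ auxE X S) :
    σ x ∈ auxE X T := by
  have h1 : auxE X S ≤ (auxE X T).comap σ := by
    refine auxE_le X fun s hs a ha => ?_
    refine auxE_mem X (h s hs) ?_
    obtain ⟨k, hk⟩ := (End.mem_maxGenEigenspace _ _ _).1 ha
    refine (End.mem_maxGenEigenspace _ _ _).2 ⟨k, ?_⟩
    have : ∀ (k : ℕ) (a : L), ((LieAlgebra.ad ℂ L X - (starRingEnd ℂ s) • 1) ^ k) (σ a) =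
        σ (((LieAlgebra.ad ℂ L X - s • 1) ^ k) a) := by
      intro k
      induction k with
      | zero => intro a; simp
      | succ k ih =>
        intro a
        rw [pow_succ, pow_succ, End.mul_apply, End.mul_apply, ← ih]
        congr 1
        simp [hbr, hX]
    rw [this, hk, map_zero]
  exact h1 hx

lemma auxE_disj (X : L) {S T : Set ℂ} (h : Disjoint S T) {x : L} (hx : x ∈ auxE X S)
    (hy : x ∈ auxE X T) : x = 0 :=
  Submodule.disjoint_def.1
    ((LieAlgebra.ad ℂ L X).independent_maxGenEigenspace.disjoint_biSup_biSup h) x hx hy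

lemma auxE_univ [FiniteDimensional ℂ L] (X : L) : auxE X Set.univ = ⊤ := by
  simp [auxE, End.iSup_maxGenEigenspace_eq_top]

lemma auxE_union (X : L) (S T : Set ℂ) : auxE X (S ∪ T) = auxE X S ⊔ auxE X T := by
  exact iSup_union

lemma auxE_orth (X : L) {S T : Set ℂ} (B : LinearMap.BilinForm ℂ L)
    (hB : ∀ u v, B ⁅X, u⁆ v = - B u ⁅X, v⁆) (h : ∀ s ∈ S, ∀ t ∈ T, s + t ≠ 0) {x y : L}
    (hx : x ∈ auxE X S) (hy : y ∈ auxE X T) : B x y = 0 := by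
  have key : ∀ s t : ℂ, s + t ≠ 0 → ∀ (k l : ℕ) (u v : L),
      ((LieAlgebra.ad ℂ L X - s • 1) ^ k) u = 0 →
      ((LieAlgebra.ad ℂ L X - t • 1) ^ l) v = 0 → B u v = 0 := by
    intro s t hst k
    induction k with
    | zero => intro l u v hu; simp at hu; simp [hu]
    | succ k ihk =>
      intro l
      induction l with
      | zero => intro u v _ hv; simp at hv; simp [hv]
      | succ l ihl =>
        intro u v hu hv
        have h1 := ihk (l + 1) ((LieAlgebra.ad ℂ L X - s • 1) u) v
          (by rw [← End.mul_apply, ← pow_succ, hu]) hv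
        have h2 := ihl u ((LieAlgebra.ad ℂ L X - t • 1) v) hu
          (by rw [← End.mul_apply, ← pow_succ, hv])
        simp [hB] at h1 h2
        have : (s + t) * B u v = 0 := by linear_combination -h1 - h2
        exact (mul_eq_zero.1 this).resolve_left hst
  have h1 : auxE X S ≤ LinearMap.ker (B.flip y) := by
    refine auxE_le X fun s hs a ha => ?_
    have h2 : auxE X T ≤ LinearMap.ker (B a) := by
      refine auxE_le X fun t ht b hb => ?_
      obtain ⟨k, hk⟩ := (End.mem_maxGenEigenspace _ _ _).1 ha
      obtain ⟨l, hl⟩ := (End.mem_maxGenEigenspace _ _ _).1 hb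
      exact key s t (h s hs t ht) k l a b hk hl
    exact h2 hy
  exact h1 hx
end grading

set_option maxHeartbeats 2000000 in
theorem aux_main (M : Type v) [AddCommGroup M] [Module ℂ M] [FiniteDimensional ℂ M] (n : ℕ) :
    ∀ (L : Type u) [LieRing L] [LieAlgebra ℂ L] [FiniteDimensional ℂ L]
    [LieRingModule L M] [LieModule ℂ L M] (σ : L →ₗ⋆[ℂ] L)
    (_ : ∀ x y, σ ⁅x, y⁆ = ⁅σ x, σ y⁆) (_ : ∀ x, σ (σ x) = x)
    (_ : ∀ x, (∀ y, LieModule.traceForm ℂ L M x y = 0) → x = 0) (_ : finrank ℂ L = n),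
    ∃ q : LieSubalgebra ℂ L, (∀ x ∈ q, σ x ∈ q → x = 0) ∧ finrank ℂ q = n / 2 := by
  induction n using Nat.strong_induction_on with
  | _ n ih =>
  intro L _ _ _ _ _ σ hbr hinv hnd hn
  by_cases hreal : ∀ X, σ X = X → ∀ μ, (LieAlgebra.ad ℂ L X).HasEigenvalue μ → μ.im = 0
  · have := aux_solvable σ hbr hinv hreal
    have hab : ∀ y z : L, ⁅y, z⁆ = 0 := fun y z => hnd _ fun x => by
      rw [LieModule.traceForm_comm]; exact aux_traceForm_solv x y z
    obtain ⟨a, ha, hak⟩ := aux_half σ hinv (n / 2) (by omega)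
    exact ⟨{ a with lie_mem' := fun {x y} _ _ => by rw [hab]; exact a.zero_mem }, ha, hak⟩
  push Not at hreal
  obtain ⟨X, hX, μ, hμ, hμi⟩ := hreal
  set S0 : Set ℂ := {s | s.im = 0}
  set Sp : Set ℂ := {s | 0 < s.im}
  set Sm : Set ℂ := {s | s.im < 0}
  have d0p : Disjoint S0 Sp := Set.disjoint_left.2 fun s h1 h2 => h2.ne' h1
  have dpm : Disjoint Sp Sm := Set.disjoint_left.2 fun s h1 h2 => absurd (show s.im < 0 from h2) (lt_asymm (show 0 < s.im from h1))
  have d0pm : Disjoint (S0 ∪ Sp) Sm := Set.disjoint_left.2 fun s h1 h2 =>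
    h1.elim (fun h => (h2 : s.im < 0).ne h) (fun h => absurd (show s.im < 0 from h2) (lt_asymm (show 0 < s.im from h)))
  have d0pm' : Disjoint S0 (Sp ∪ Sm) := Set.disjoint_left.2 fun s h1 h2 =>
    h2.elim (fun h => (h : 0 < s.im).ne' h1) (fun h => (h : s.im < 0).ne h1)
  have htop : auxE X S0 ⊔ auxE X Sp ⊔ auxE X Sm = ⊤ := by
    rw [← auxE_union, ← auxE_union, ← auxE_univ X]
    congr 1
    ext s
    rcases lt_trichotomy s.im 0 with h | h | h <;> simp [S0, Sp, Sm, h]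
  have hmap : auxE X Sm = (auxE X Sp).map σ := by
    ext x
    rw [Submodule.mem_map]
    constructor
    · intro hx
      exact ⟨σ x, auxE_conj σ hbr hX (fun s (hs : s.im < 0) => by simpa [Sp] using hs) hx, hinv x⟩
    · rintro ⟨y, hy, rfl⟩
      exact auxE_conj σ hbr hX (fun s (hs : 0 < s.im) => by simpa [Sm] using hs) hy
  have hdim : finrank ℂ (auxE X S0) + 2 * finrank ℂ (auxE X Sp) = n := by
    have h1 := Submodule.finrank_sup_add_finrank_inf_eq (auxE X S0) (auxE X Sp)
    have h2 := Submodule.finrank_sup_add_finrank_inf_eq (auxE X S0 ⊔ auxE X Sp) (auxE X Sm)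
    have h3 : auxE X S0 ⊓ auxE X Sp = ⊥ := by
      rw [Submodule.eq_bot_iff]; exact fun x hx => auxE_disj X d0p hx.1 hx.2
    have h4 : (auxE X S0 ⊔ auxE X Sp) ⊓ auxE X Sm = ⊥ := by
      rw [← auxE_union, Submodule.eq_bot_iff]; exact fun x hx => auxE_disj X d0pm hx.1 hx.2
    have h5 : finrank ℂ (auxE X Sm) = finrank ℂ (auxE X Sp) := by
      rw [hmap, aux_finrank_map σ hinv]
    rw [htop, h4, finrank_top, finrank_bot] at h2
    rw [h3, finrank_bot] at h1
    omega
  let L' : LieSubalgebra ℂ L :=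
    { auxE X S0 with
      lie_mem' := fun {x y} hx hy => auxE_lie X
        (fun s (hs : s.im = 0) t (ht : t.im = 0) => by simp [S0, hs, ht]) hx hy }
  have hσL : ∀ x ∈ L', σ x ∈ L' := fun x hx =>
    auxE_conj σ hbr hX (fun s (hs : s.im = 0) => by simp [S0, hs]) hx
  let σ' : L' →ₗ⋆[ℂ] L' :=
    { toFun := fun x => ⟨σ x, hσL x x.2⟩
      map_add' := fun x y => by ext; simp
      map_smul' := fun c x => by ext; simp }
  have hL'dim : finrank ℂ L' = finrank ℂ (auxE X S0) := rfl
  have hlt : finrank ℂ L' < n := by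
    by_contra hcon
    have hE0 : auxE X S0 = ⊤ := Submodule.eq_top_of_finrank_eq (by omega)
    obtain ⟨v, hv⟩ := hμ.exists_hasEigenvector
    have h1 : v ∈ auxE X {μ} := auxE_mem X (Set.mem_singleton μ)
      ((End.mem_maxGenEigenspace _ _ _).2 ⟨1, by simp [hv.apply_eq_smul]⟩)
    apply hv.2
    refine auxE_disj X (S := S0) ?_ (by rw [hE0]; trivial) h1
    simpa [S0] using hμi
  have hnd' : ∀ x : L', (∀ y : L', LieModule.traceForm ℂ L' M x y = 0) → x = 0 := by
    intro x hx
    apply Subtype.ext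
    apply hnd
    intro y
    have hy : y ∈ auxE X S0 ⊔ auxE X Sp ⊔ auxE X Sm := by rw [htop]; trivial
    rw [sup_assoc, ← auxE_union] at hy
    obtain ⟨a, ha, b, hb, rfl⟩ := Submodule.mem_sup.1 hy
    have h1 : LieModule.traceForm ℂ L M x a = 0 := hx ⟨a, ha⟩
    have h2 : LieModule.traceForm ℂ L M x b = 0 :=
      auxE_orth X _ (LieModule.traceForm_apply_lie_apply' ℂ L M X) (by
        intro s (hs : s.im = 0) t ht h0
        have h3 := congrArg Complex.im h0
        simp [hs] at h3
        rcases ht with h | h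
        · exact (h : 0 < t.im).ne' h3
        · exact (h : t.im < 0).ne h3) x.2 hb
    rw [map_add, h1, h2, add_zero]
  obtain ⟨q', hq', hq'd⟩ := ih _ hlt L' σ' (fun x y => by ext; exact hbr x y)
    (fun x => by ext; exact hinv x) hnd' rfl
  set Q : Submodule ℂ L := q'.toSubmodule.map L'.toSubmodule.subtype with hQ
  have hQ0 : Q ≤ auxE X S0 := by
    rintro _ ⟨x, hx, rfl⟩
    exact x.2
  have hQd : finrank ℂ Q = finrank ℂ (auxE X S0) / 2 := by
    rw [← hL'dim, ← hq'd]
    exact (Submodule.equivMapOfInjective L'.toSubmodule.subtype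
      Subtype.val_injective q'.toSubmodule).finrank_eq.symm
  have hQσ : ∀ x ∈ Q, σ x ∈ Q → x = 0 := by
    rintro _ ⟨x, hx, rfl⟩ ⟨y, hy, he⟩
    have : y = σ' x := Subtype.ext he
    subst this
    have := hq' x hx hy
    simp [this]
  have l0p : ∀ x ∈ auxE X S0, ∀ y ∈ auxE X Sp, ⁅x, y⁆ ∈ auxE X Sp := fun x hx y hy =>
    auxE_lie X (fun s (hs : s.im = 0) t (ht : 0 < t.im) => by simpa [Sp, hs] using ht) hx hy
  have lpp : ∀ x ∈ auxE X Sp, ∀ y ∈ auxE X Sp, ⁅x, y⁆ ∈ auxE X Sp := fun x hx y hy =>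
    auxE_lie X (fun s (hs : 0 < s.im) t (ht : 0 < t.im) => by
      show 0 < (s + t).im
      rw [Complex.add_im]; exact add_pos hs ht) hx hy
  refine ⟨{ Q ⊔ auxE X Sp with lie_mem' := ?_ }, ?_, ?_⟩
  · intro x y hx hy
    obtain ⟨a, ha, b, hb, rfl⟩ := Submodule.mem_sup.1 hx
    obtain ⟨c, hc, d, hd, rfl⟩ := Submodule.mem_sup.1 hy
    refine Submodule.mem_sup.2 ⟨⁅a, c⁆, ?_, ⁅a, d⁆ + ⁅b, c⁆ + ⁅b, d⁆, ?_, ?_⟩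
    · obtain ⟨a, ha, rfl⟩ := ha
      obtain ⟨c, hc, rfl⟩ := hc
      exact ⟨Bracket.bracket (L := L') (M := L') a c, q'.lie_mem ha hc, rfl⟩
    · refine Submodule.add_mem _ (Submodule.add_mem _ (l0p _ (hQ0 ha) _ hd) ?_) (lpp _ hb _ hd)
      rw [← lie_skew]
      exact Submodule.neg_mem _ (l0p _ (hQ0 hc) _ hb)
    · simp only [add_lie, lie_add]; abel
  · intro x hx hσx
    obtain ⟨a, ha, b, hb, rfl⟩ := Submodule.mem_sup.1 (hx : x ∈ Q ⊔ auxE X Sp)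
    obtain ⟨c, hc, d, hd, he⟩ := Submodule.mem_sup.1 (hσx : _ ∈ Q ⊔ auxE X Sp)
    have hσa : σ a ∈ auxE X S0 := hσL a (hQ0 ha)
    have hσb : σ b ∈ auxE X Sm := by rw [hmap]; exact Submodule.mem_map_of_mem hb
    rw [map_add] at he
    have h1 : σ b = 0 := by
      refine auxE_disj X d0pm ?_ hσb
      have : σ b = (c - σ a) + d := by
        rw [sub_add_eq_add_sub, he]; abel
      rw [this, auxE_union]
      exact Submodule.add_mem_sup (Submodule.sub_mem _ (hQ0 hc) hσa) hd
    have hb0 : b = 0 := by rw [← hinv b, h1, map_zero]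
    have h2 : d = 0 := by
      refine auxE_disj X d0p ?_ hd
      have : d = σ a - c := by rw [eq_sub_iff_add_eq', he, h1, add_zero]
      rw [this]
      exact Submodule.sub_mem _ hσa (hQ0 hc)
    subst hb0 h2
    simp only [map_zero, add_zero] at he ⊢
    exact hQσ a ha (he ▸ hc)
  · show finrank ℂ (Q ⊔ auxE X Sp : Submodule ℂ L) = n / 2
    have h1 := Submodule.finrank_sup_add_finrank_inf_eq Q (auxE X Sp)
    have h3 : Q ⊓ auxE X Sp = ⊥ := by
      rw [Submodule.eq_bot_iff]; exact fun x hx => auxE_disj X d0p (hQ0 hx.1) hx.2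
    rw [h3, finrank_bot] at h1
    omega


/-- Every odd-dimensional complex semisimple Lie algebra with a conjugation `σ`
admits a complex Lie subalgebra `𝔮` with `𝔮 ∩ σ(𝔮) = 0` and
`dim_ℂ (𝔮 + σ(𝔮)) = dim_ℂ 𝔤 − 1`, i.e. a left-invariant CR structure of
hypersurface type on the corresponding real Lie group. -/
theorem stmt_7 {g : Type*} [LieRing g] [LieAlgebra ℂ g] [FiniteDimensional ℂ g]
    [LieAlgebra.IsSemisimple ℂ g]
    (σ : g → g)
    (hσadd : ∀ x y, σ (x + y) = σ x + σ y)
    (hσsmul : ∀ (z : ℂ) (x : g), σ (z • x) = (starRingEnd ℂ z) • σ x)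
    (hσbracket : ∀ x y, σ ⁅x, y⁆ = ⁅σ x, σ y⁆)
    (hσinv : ∀ x, σ (σ x) = x)
    (hodd : Odd (Module.finrank ℂ g)) :
    ∃ q : LieSubalgebra ℂ g,
      (∀ x ∈ q, σ x ∈ q → x = 0) ∧
      Module.finrank ℂ
        (q.toSubmodule ⊔ Submodule.span ℂ (σ '' (q : Set g)) : Submodule ℂ g)
        = Module.finrank ℂ g - 1 := by
  let τ : g →ₗ⋆[ℂ] g := { toFun := σ, map_add' := hσadd, map_smul' := hσsmul }
  obtain ⟨q, hq, hqd⟩ := aux_main g _ g τ hσbracket hσinv (by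
    intro x hx
    exact (LieAlgebra.IsKilling.killingForm_nondegenerate ℂ g).1 x hx) rfl
  refine ⟨q, hq, ?_⟩
  have h0 : Submodule.span ℂ (σ '' (q : Set g)) = q.toSubmodule.map τ := by
    have : σ '' (q : Set g) = (q.toSubmodule.map τ : Set g) := rfl
    rw [this, Submodule.span_eq]
  rw [h0]
  have h1 := Submodule.finrank_sup_add_finrank_inf_eq q.toSubmodule (q.toSubmodule.map τ)
  have h2 : q.toSubmodule ⊓ q.toSubmodule.map τ = ⊥ := by
    rw [Submodule.eq_bot_iff]
    rintro x ⟨hx, y, hy, rfl⟩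
    exact hq _ hx (by rw [show τ (τ y) = y from hσinv y]; exact hy)
  rw [h2, finrank_bot, aux_finrank_map τ hσinv] at h1
  have h3 : finrank ℂ q.toSubmodule = finrank ℂ g / 2 := hqd
  obtain ⟨m, hm⟩ := hodd
  omega
end
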